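/- Nonabelian Stokes estimate: let A be a smooth g-valued connection on an open set containing a solid triangle Δ(x₀,x₁,x₂) ⊂ ℝⁿ, and let A[[x₀→x₁→x₂→x₀]] ∈ G denote the holonomy (parallel transport) of A around the triangular loop. Then |A[[x₀→x₁→x₂→x₀]] − 1_G| ≤ C ∫_{Δ(x₀,x₁,x₂)} |F(A)(y)| dH²(y), where F(A) = dA + A∧A is the curvature and H² is 2-dimensional Hausdorff measure. -/

import Mathlib

open MeasureTheory Metric

/-- Operators on ℂ^N, the ambient space in which the compact group G ⊆ U(N) lives. -/
abbrev MatN (N : ℕ) := EuclideanSpace ℂ (Fin N) →L[ℂ] EuclideanSpace ℂ (Fin N)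

/-- Pointwise norm of the curvature F(A) = dA + A ∧ A of a g-valued connection
1-form A, measured as the supremum over pairs of unit directions. -/
noncomputable def curvNorm (n N : ℕ)
    (A : EuclideanSpace ℝ (Fin n) → (EuclideanSpace ℝ (Fin n) →L[ℝ] MatN N))
    (z : EuclideanSpace ℝ (Fin n)) : ℝ :=
  ⨆ v : Metric.sphere (0 : EuclideanSpace ℝ (Fin n)) 1,
    ⨆ w : Metric.sphere (0 : EuclideanSpace ℝ (Fin n)) 1,
      ‖fderiv ℝ A z v w - fderiv ℝ A z w v
        + A z v * A z w - A z w * A z v‖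

section StokesAux

variable {M : Type*} [NormedRing M] [NormedAlgebra ℝ M]

theorem st_const [StarRing M] [CStarRing M] [StarModule ℝ M] {f g b : ℝ → M} {σ τ : ℝ}
    (hf : ∀ t ∈ Set.Icc σ τ, HasDerivAt f (f t * b t) t)
    (hg : ∀ t ∈ Set.Icc σ τ, HasDerivAt g (g t * b t) t)
    (hfu : ∀ t, f t ∈ unitary M) :
    ∀ t ∈ Set.Icc σ τ, f t * star (g t) = f σ * star (g σ) := by
  have hskew : ∀ t ∈ Set.Icc σ τ, star (b t) + b t = 0 := by
    intro t ht
    have h1 := (hf t ht).star.mul (hf t ht)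
    have h2 : (star f * f : ℝ → M) = fun _ => 1 := by
      funext s
      exact Unitary.star_mul_self_of_mem (hfu s)
    have h2' : ((fun x => star (f x)) * f : ℝ → M) = fun _ => 1 := h2
    rw [h2'] at h1
    have h3 := h1.unique (hasDerivAt_const t (1:M))
    have h4 := Unitary.star_mul_self_of_mem (hfu t)
    rw [star_mul, mul_assoc, ← mul_assoc (star (f t)), h4] at h3
    simpa using h3
  have hd : ∀ t ∈ Set.Icc σ τ, HasDerivAt (fun t => f t * star (g t)) 0 t := by
    intro t ht
    have h1 := (hf t ht).mul (hg t ht).star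
    refine HasDerivAt.congr_deriv (f := fun t => f t * star (g t)) h1 ?_
    have : f t * (star (b t) + b t) * star (g t) = 0 := by rw [hskew t ht]; simp
    rw [star_mul]
    refine Eq.trans ?_ this
    noncomm_ring
  apply constant_of_has_deriv_right_zero
  · intro t ht
    exact (hd t ht).continuousAt.continuousWithinAt
  · intro t ht
    exact (hd t (Set.Ico_subset_Icc_self ht)).hasDerivWithinAt

theorem st_ode {p b : ℝ → M} {α β γ : M} {a c η : ℝ}
    (hp0 : p 0 = 1) (hp1 : ∀ t x, ‖p t * x‖ ≤ ‖x‖)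
    (hp : ∀ t ∈ Set.Icc (0:ℝ) 1, HasDerivAt p (p t * b t) t)
    (hα : ‖α‖ ≤ a) (hβ : ‖β‖ ≤ c) (hγ : ‖γ‖ ≤ c)
    (hb : ∀ t ∈ Set.Icc (0:ℝ) 1, ‖b t - α - β - t • γ‖ ≤ η) :
    ‖p 1 - 1‖ ≤ a + 2 * c + η ∧ ‖p 1 - 1 - α‖ ≤ (a + 2 * c + η)^2 + 2 * c + η ∧
    ‖p 1 - 1 - α - β - (1/2 : ℝ) • γ - (1/2:ℝ) • (α * α)‖ ≤
      ((a + 2 * c + η)^2 + 2 * c + η) * (a + 2 * c + η) + a * (2 * c + η) + η := by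
  have ha0 : 0 ≤ a := (norm_nonneg _).trans hα
  have hc0 : 0 ≤ c := (norm_nonneg _).trans hβ
  have hη0 : 0 ≤ η := (norm_nonneg _).trans (hb 0 (by simp))
  have hbα : ∀ t ∈ Set.Icc (0:ℝ) 1, ‖b t - α‖ ≤ 2 * c + η := by
    intro t ht
    have e : b t - α = (b t - α - β - t • γ) + β + t • γ := by abel
    have h3 : ‖t • γ‖ ≤ c := by
      rw [norm_smul, Real.norm_eq_abs, abs_of_nonneg ht.1]
      nlinarith [ht.2, ht.1, norm_nonneg γ]
    rw [e]
    refine (norm_add₃_le).trans ?_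
    linarith [hb t ht]
  have hbm : ∀ t ∈ Set.Icc (0:ℝ) 1, ‖b t‖ ≤ a + 2 * c + η := by
    intro t ht
    have e : b t = (b t - α) + α := by abel
    rw [e]
    refine (norm_add_le _ _).trans ?_
    linarith [hbα t ht]
  set m := a + 2 * c + η with hm
  have hm0 : 0 ≤ m := by positivity
  have key : ∀ (f f' : ℝ → M) (C : ℝ), (∀ t ∈ Set.Icc (0:ℝ) 1, HasDerivAt f (f' t) t) →
      (∀ t ∈ Set.Icc (0:ℝ) 1, ‖f' t‖ ≤ C) → ∀ t ∈ Set.Icc (0:ℝ) 1, ‖f t - f 0‖ ≤ C := by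
    intro f f' C h1 h2 t ht
    have := Convex.norm_image_sub_le_of_norm_hasDerivWithin_le (f := f) (f' := f') (C := C)
      (s := Set.Icc (0:ℝ) 1) (x := 0) (y := t)
      (fun x hx => (h1 x hx).hasDerivWithinAt) h2 (convex_Icc _ _) (by simp) ht
    refine this.trans ?_
    have hC : 0 ≤ C := (norm_nonneg _).trans (h2 0 (by simp))
    rw [sub_zero, Real.norm_eq_abs, abs_of_nonneg ht.1]
    nlinarith [ht.2]
  have s1 : ∀ t ∈ Set.Icc (0:ℝ) 1, ‖p t - 1‖ ≤ m := by
    intro t ht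
    have := key p _ m hp (fun t ht => (hp1 t _).trans (hbm t ht)) t ht
    rwa [hp0] at this
  have hid : ∀ (x : M) (t : ℝ), HasDerivAt (fun s : ℝ => s • x) x t := by
    intro x t
    simpa using (hasDerivAt_id t).smul_const x
  have s2 : ∀ t ∈ Set.Icc (0:ℝ) 1, ‖p t - 1 - t • α‖ ≤ m^2 + 2 * c + η := by
    intro t ht
    have := key (fun t => p t - t • α) (fun t => p t * b t - α) (m^2 + 2 * c + η)
      (fun t ht => (hp t ht).sub (hid α t)) ?_ t ht
    · simp only [hp0, zero_smul, sub_zero] at this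
      convert this using 2
      abel
    · intro t ht
      have e : p t * b t - α = (p t - 1) * b t + (b t - α) := by noncomm_ring
      rw [e]
      refine (norm_add_le _ _).trans ?_
      have h1 : ‖(p t - 1) * b t‖ ≤ m * m := (norm_mul_le _ _).trans
        (mul_le_mul (s1 t ht) (hbm t ht) (norm_nonneg _) hm0)
      nlinarith [hbα t ht]
  set m2 := m^2 + 2 * c + η with hm2
  have hm20 : 0 ≤ m2 := by positivity
  have hone : (1:ℝ) ∈ Set.Icc (0:ℝ) 1 := by simp
  refine ⟨s1 1 hone, by simpa using s2 1 hone, ?_⟩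
  have hsq : ∀ (x : M) (t : ℝ), HasDerivAt (fun s : ℝ => (1/2 * s^2) • x) (t • x) t := by
    intro x t
    have h := (((hasDerivAt_id t).pow 2).const_mul (1/2:ℝ)).smul_const x
    refine HasDerivAt.congr_deriv (f := fun s : ℝ => (1/2 * s^2) • x) h ?_
    simp
  have := key (fun t => p t - t • α - t • β - (1/2 * t^2) • γ - (1/2 * t^2) • (α * α))
    (fun t => p t * b t - α - β - t • γ - t • (α * α)) (m2 * m + a * (2 * c + η) + η)
    (fun t ht => ((((hp t ht).sub (hid α t)).sub (hid β t)).sub (hsq γ t)).sub (hsq _ t))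
    ?_ 1 hone
  · convert this using 2
    simp [hp0]
    abel
  · intro t ht
    have e : p t * b t - α - β - t • γ - t • (α * α) =
      (p t - 1 - t • α) * b t + (t • α) * (b t - α) + (b t - α - β - t • γ) := by
      simp only [sub_mul, mul_sub, smul_mul_assoc, one_mul]
      abel
    rw [e]
    refine (norm_add₃_le).trans ?_
    have h1 : ‖(p t - 1 - t • α) * b t‖ ≤ m2 * m := (norm_mul_le _ _).trans
        (mul_le_mul (s2 t ht) (hbm t ht) (norm_nonneg _) hm20)
    have h3 : ‖t • α‖ ≤ a := by
      rw [norm_smul, Real.norm_eq_abs, abs_of_nonneg ht.1]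
      nlinarith [ht.2, ht.1, norm_nonneg α]
    have h2 : ‖(t • α) * (b t - α)‖ ≤ a * (2 * c + η) := (norm_mul_le _ _).trans
        (mul_le_mul h3 (hbα t ht) (norm_nonneg _) ha0)
    linarith [hb t ht]

theorem st_prod {p1 p2 p3 α1 α2 β1 β2 β3 γ1 γ2 γ3 : M} {a c m m2 m3 : ℝ}

    (hp1 : ∀ x, ‖x * p2‖ ≤ ‖x‖)
    (ha : ‖α1‖ ≤ a) (hb : ‖β1‖ ≤ c) (hc : ‖γ1‖ ≤ c)
    (h2 : ‖p2 - 1‖ ≤ m) (h2' : ‖p2 - 1 - α2‖ ≤ m2)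
    (e1 : ‖p1 - 1 - α1 - β1 - (1/2 : ℝ) • γ1 - (1/2:ℝ) • (α1 * α1)‖ ≤ m3)
    (e2 : ‖p2 - 1 - α2 - β2 - (1/2 : ℝ) • γ2 - (1/2:ℝ) • (α2 * α2)‖ ≤ m3)
    (e3 : ‖p3 - 1 - (α1 + α2) - β3 - (1/2 : ℝ) • γ3 -
      (1/2:ℝ) • ((α1 + α2) * (α1 + α2))‖ ≤ m3) :
    ‖p1 * p2 - p3‖ ≤ ‖(β1 + β2 - β3) + (1/2 : ℝ) • (γ1 + γ2 - γ3) +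
      (1/2:ℝ) • (α1 * α2 - α2 * α1)‖ + 3 * m3 + a * m2 + (2 * c + a^2) * m := by
  have ha0 : 0 ≤ a := (norm_nonneg _).trans ha
  have hc0 : 0 ≤ c := (norm_nonneg _).trans hb
  set r1 := p1 - 1 - α1 - β1 - (1/2 : ℝ) • γ1 - (1/2:ℝ) • (α1 * α1) with hr1
  set r2 := p2 - 1 - α2 - β2 - (1/2 : ℝ) • γ2 - (1/2:ℝ) • (α2 * α2) with hr2
  set r3 := p3 - 1 - (α1 + α2) - β3 - (1/2 : ℝ) • γ3 -
      (1/2:ℝ) • ((α1 + α2) * (α1 + α2)) with hr3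
  set q := β1 + (1/2 : ℝ) • γ1 + (1/2:ℝ) • (α1 * α1) with hq
  set X := (β1 + β2 - β3) + (1/2 : ℝ) • (γ1 + γ2 - γ3) +
      (1/2:ℝ) • (α1 * α2 - α2 * α1) with hX
  have e : p1 * p2 - p3 = X + r1 * p2 + r2 + α1 * (p2 - 1 - α2) + q * (p2 - 1) - r3 := by
    rw [hX, hr1, hr2, hr3, hq]
    simp only [sub_mul, mul_sub, add_mul, mul_add, smul_mul_assoc, one_mul, mul_one, smul_add,
      smul_sub]
    module
  have hhalf : ∀ x : M, ‖(1/2:ℝ) • x‖ ≤ ‖x‖ := by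
    intro x
    rw [norm_smul]; norm_num
    linarith [norm_nonneg x]
  have hqn : ‖q‖ ≤ 2 * c + a^2 := by
    refine (norm_add₃_le).trans ?_
    have : ‖α1 * α1‖ ≤ a * a := (norm_mul_le _ _).trans
      (mul_le_mul ha ha (norm_nonneg _) ha0)
    nlinarith [hhalf γ1, hhalf (α1 * α1)]
  have t1 : ‖r1 * p2‖ ≤ m3 := (hp1 _).trans e1
  have t2 : ‖α1 * (p2 - 1 - α2)‖ ≤ a * m2 := (norm_mul_le _ _).trans
    (mul_le_mul ha h2' (norm_nonneg _) ha0)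
  have t3 : ‖q * (p2 - 1)‖ ≤ (2 * c + a^2) * m := (norm_mul_le _ _).trans
    (mul_le_mul hqn h2 (norm_nonneg _) (by positivity))
  rw [e]
  have u1 := norm_sub_le (X + r1 * p2 + r2 + α1 * (p2 - 1 - α2) + q * (p2 - 1)) r3
  have u2 := norm_add_le (X + r1 * p2 + r2 + α1 * (p2 - 1 - α2)) (q * (p2 - 1))
  have u3 := norm_add_le (X + r1 * p2 + r2) (α1 * (p2 - 1 - α2))
  have u4 := norm_add_le (X + r1 * p2) r2
  have u5 := norm_add_le X (r1 * p2)
  linarith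

end StokesAux


theorem st_num {K θ ε δ : ℝ} (hK1 : 1 ≤ K) (hθ0 : 0 ≤ θ) (hθ1 : θ ≤ 1) (hθ2 : θ ≤ δ / 6)
    (hε : 0 < ε) (hε1 : ε ≤ 1) (hε2 : ε * (600 * K^3) ≤ δ) :
    3 * (((K * ε + 2 * (K * ε^2) + θ * ε^2)^2 + 2 * (K * ε^2) + θ * ε^2) *
      (K * ε + 2 * (K * ε^2) + θ * ε^2) + K * ε * (2 * (K * ε^2) + θ * ε^2) + θ * ε^2) +
      K * ε * ((K * ε + 2 * (K * ε^2) + θ * ε^2)^2 + 2 * (K * ε^2) + θ * ε^2) +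
      (2 * (K * ε^2) + (K * ε)^2) * (K * ε + 2 * (K * ε^2) + θ * ε^2) ≤ δ * ε^2 := by
  set m := K * ε + 2 * (K * ε^2) + θ * ε^2 with hm
  have hm1 : m ≤ 4 * K * ε := by
    have : ε^2 ≤ ε := by nlinarith
    have h5 : K * ε^2 ≤ K * ε := by gcongr
    have h6 : θ * ε^2 ≤ K * ε := mul_le_mul (hθ1.trans hK1) this (by positivity) (by positivity)
    linarith
  have hm0 : 0 ≤ m := by positivity
  have hK0 : 0 < K := by linarith
  have hKK : K ≤ K^2 := by nlinarith
  have hc1 : 2 * (K * ε^2) + θ * ε^2 ≤ 3 * K * ε^2 := by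
    have : θ * ε^2 ≤ K * ε^2 := by gcongr; linarith
    linarith
  have hm2 : m^2 + 2 * (K * ε^2) + θ * ε^2 ≤ 19 * K^2 * ε^2 := by
    have : m^2 ≤ (4 * K * ε)^2 := by gcongr
    have : K * ε^2 ≤ K^2 * ε^2 := by gcongr
    nlinarith
  set m2 := m^2 + 2 * (K * ε^2) + θ * ε^2 with hm2d
  have hm20 : 0 ≤ m2 := by positivity
  have g1 : m2 * m ≤ (19 * K^2 * ε^2) * (4 * K * ε) := by gcongr
  have g2 : K * ε * (2 * (K * ε^2) + θ * ε^2) ≤ K * ε * (3 * K * ε^2) := by gcongr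
  have g3 : K * ε * m2 ≤ K * ε * (19 * K^2 * ε^2) := by gcongr
  have g4 : (2 * (K * ε^2) + (K * ε)^2) * m ≤ (3 * K^2 * ε^2) * (4 * K * ε) := by
    gcongr
    have : K * ε^2 ≤ K^2 * ε^2 := by gcongr
    nlinarith
  have g5 : K^2 * ε^3 ≤ K^3 * ε^3 := by
    gcongr
    norm_num
  have g6 : ε * (600 * K^3) * ε^2 ≤ δ * ε^2 := by gcongr
  have g7 : θ * ε^2 ≤ δ / 6 * ε^2 := by gcongr
  have g8 : (0:ℝ) ≤ K^3 * ε^3 := by positivity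
  nlinarith

section StokesGeom

variable {M : Type*} [NormedRing M] [NormedAlgebra ℝ M] [StarRing M] [CStarRing M]
  [StarModule ℝ M] {E : Type*} [NormedAddCommGroup E] [NormedSpace ℝ E]

/-- the parallel transport hypotheses -/
def StPT (A : E → E →L[ℝ] M) (P : E → E → M) (U : Set E) : Prop :=
  (∀ x, P x x = 1) ∧
  (∀ x y : E, segment ℝ x y ⊆ U →
        ∀ t ∈ Set.Icc (0:ℝ) 1,
          HasDerivAt (fun s : ℝ => P x (x + s • (y - x)))
            (P x (x + t • (y - x)) * A (x + t • (y - x)) (y - x)) t) ∧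
  (∀ x y, P x y ∈ unitary M)

theorem st_inv {A : E → E →L[ℝ] M} {P : E → E → M} {U : Set E} (h : StPT A P U) {x y : E}
    (hs : segment ℝ x y ⊆ U) : P x y * P y x = 1 := by
  obtain ⟨h1, h2, h3⟩ := h
  have k := st_const (f := fun s : ℝ => P x (x + s • (y - x)))
    (g := fun s : ℝ => P y (x + s • (y - x))) (b := fun t => A (x + t • (y - x)) (y - x))
    (σ := 0) (τ := 1) (h2 x y hs) ?_ (fun t => h3 _ _) 1 (by simp)
  · simp only [one_smul, zero_smul, add_zero, h1, add_sub_cancel, star_one, mul_one, one_mul] at k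
    rw [k]
    exact Unitary.star_mul_self_of_mem (h3 _ _)
  · intro t ht
    have hs' : segment ℝ y x ⊆ U := by rwa [segment_symm]
    have d := h2 y x hs' (1 - t) ⟨by linarith [ht.2], by linarith [ht.1]⟩
    have d' := d.scomp t ((hasDerivAt_id t).const_sub 1)
    have e : ∀ s : ℝ, y + (1 - s) • (x - y) = x + s • (y - x) := by intro s; module
    simp only [e] at d'
    have ef : (fun s : ℝ => P y (x + s • (y - x))) =
        (fun s => P y (y + s • (x - y))) ∘ HSub.hSub 1 := by
      funext s
      simp [e]
    rw [ef]
    refine d'.congr_deriv ?_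
    simp only [map_sub, neg_smul, one_smul]
    rw [← mul_neg, neg_sub]

theorem st_mid {A : E → E →L[ℝ] M} {P : E → E → M} {U : Set E} (h : StPT A P U) {x z m : E}
    (hs : segment ℝ x z ⊆ U) (hm : m = x + (1/2:ℝ) • (z - x)) : P x z = P x m * P m z := by
  obtain ⟨h1, h2, h3⟩ := h
  have hmem : m ∈ segment ℝ x z := by
    rw [segment_eq_image']
    exact ⟨1/2, by norm_num, hm.symm⟩
  have k := st_const (f := fun s : ℝ => P x (x + s • (z - x)))
    (g := fun s : ℝ => P m (x + s • (z - x))) (b := fun t => A (x + t • (z - x)) (z - x))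
    (σ := 1/2) (τ := 1) (fun t ht => h2 x z hs t ⟨by linarith [ht.1], ht.2⟩) ?_
    (fun t => h3 _ _) 1 (by norm_num)
  · simp only [one_smul, ← hm, h1, add_sub_cancel, star_one, mul_one] at k
    rw [← k, mul_assoc, Unitary.star_mul_self_of_mem (h3 _ _), mul_one]
  · intro t ht
    have hs' : segment ℝ m z ⊆ U :=
      ((convex_segment x z).segment_subset hmem (right_mem_segment ℝ x z)).trans hs
    have d := h2 m z hs' (2 * t - 1) ⟨by linarith [ht.1], by linarith [ht.2]⟩
    have d' := d.scomp t (((hasDerivAt_id t).const_mul 2).sub_const 1)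
    have e : ∀ s : ℝ, m + (2 * s - 1) • (z - m) = x + s • (z - x) := by
      intro s; rw [hm]; module
    simp only [id, e] at d'
    have ef : (fun s : ℝ => P m (x + s • (z - x))) =
        (fun s => P m (m + s • (z - m))) ∘ fun x => 2 * x - 1 := by
      funext s
      simp [e]
    rw [ef]
    refine d'.congr_deriv ?_
    have : z - x = (2:ℝ) • (z - m) := by rw [hm]; module
    nth_rewrite 5 [this]
    rw [map_smul]
    simp

theorem st_local {A : E → E →L[ℝ] M} {P : E → E → M} {U : Set E} (h : StPT A P U) {z : E}
    {D : E →L[ℝ] E →L[ℝ] M} (hA : HasFDerivAt A D z) (L : ℝ) (hL : 0 ≤ L) (δ : ℝ) (hδ : 0 < δ) :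
    ∃ r > 0, ∀ (x u1 u2 : E) (ε : ℝ), 0 < ε → ε < r →
      segment ℝ x (x + u1) ⊆ U → segment ℝ (x + u1) (x + u1 + u2) ⊆ U →
      segment ℝ x (x + u1 + u2) ⊆ U →
      ‖x - z‖ ≤ L * ε → ‖x + u1 - z‖ ≤ L * ε → ‖u1‖ ≤ L * ε → ‖u2‖ ≤ L * ε →
      ‖u1 + u2‖ ≤ L * ε →
      ‖P x (x + u1) * P (x + u1) (x + u1 + u2) - P x (x + u1 + u2)‖ ≤
        1/2 * ‖D u1 u2 - D u2 u1 + A z u1 * A z u2 - A z u2 * A z u1‖ + δ * ε^2 := by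
  obtain ⟨h1, h2, h3⟩ := h
  set K := ‖A z‖ * L + ‖D‖ * L * L + 1 with hK
  have hK1 : 1 ≤ K := by
    have : 0 ≤ ‖A z‖ * L + ‖D‖ * L * L := by positivity
    linarith
  set θ := min 1 (δ/6) with hθ
  have hθ0 : 0 < θ := lt_min one_pos (by positivity)
  set κ := θ / (2 * L * L + 1) with hκ
  have hκ0 : 0 < κ := by positivity
  obtain ⟨r0, hr0, hr⟩ := Metric.eventually_nhds_iff.1 (hA.isLittleO.def hκ0)
  set r := min (min 1 (δ / (600 * K^3))) (r0 / (2 * L + 1)) with hr'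
  refine ⟨r, by positivity, ?_⟩
  intro x u1 u2 ε hε hεr s1 s2 s3 b1 b2 b3 b4 b5
  have hε1 : ε ≤ 1 := hεr.le.trans ((min_le_left _ _).trans (min_le_left _ _))
  have hε2 : ε * (600 * K^3) ≤ δ := by
    have : ε ≤ δ / (600 * K^3) := hεr.le.trans ((min_le_left _ _).trans (min_le_right _ _))
    rwa [le_div_iff₀ (by positivity)] at this
  have hε3 : ε * (2 * L + 1) < r0 := by
    have : ε < r0 / (2 * L + 1) := hεr.trans_le (min_le_right _ _)
    rwa [lt_div_iff₀ (by positivity)] at this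
  have hp : ∀ (p : M), p ∈ unitary M → (∀ x, ‖p * x‖ ≤ ‖x‖) ∧ (∀ x, ‖x * p‖ ≤ ‖x‖) := by
    intro p hp
    exact ⟨fun x => (CStarRing.norm_mem_unitary_mul x hp).le,
      fun x => (CStarRing.norm_mul_mem_unitary x hp).le⟩
  have hα : ∀ u : E, ‖u‖ ≤ L * ε → ‖A z u‖ ≤ K * ε := by
    intro u hu
    calc ‖A z u‖ ≤ ‖A z‖ * ‖u‖ := (A z).le_opNorm u
      _ ≤ ‖A z‖ * (L * ε) := by gcongr
      _ = (‖A z‖ * L) * ε := by ring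
      _ ≤ K * ε := by
        gcongr
        have : 0 ≤ ‖D‖ * L * L := by positivity
        linarith
  have hβ : ∀ u u' : E, ‖u‖ ≤ L * ε → ‖u'‖ ≤ L * ε → ‖D u u'‖ ≤ K * ε^2 := by
    intro u u' hu hu'
    calc ‖D u u'‖ ≤ ‖D‖ * ‖u‖ * ‖u'‖ := D.le_opNorm₂ u u'
      _ ≤ ‖D‖ * (L * ε) * (L * ε) := by gcongr
      _ = (‖D‖ * L * L) * ε^2 := by ring
      _ ≤ K * ε^2 := by
        gcongr
        have : 0 ≤ ‖A z‖ * L := by positivity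
        linarith
  have edge : ∀ (x u : E), segment ℝ x (x + u) ⊆ U → ‖x - z‖ ≤ L * ε → ‖u‖ ≤ L * ε →
      _ := fun x u hs hx hu => by
    have ode := h2 x (x + u) hs
    simp only [add_sub_cancel_left] at ode
    have := st_ode (p := fun s : ℝ => P x (x + s • u)) (b := fun t : ℝ => A (x + t • u) u)
      (α := A z u) (β := D (x - z) u) (γ := D u u) (a := K * ε) (c := K * ε^2) (η := θ * ε^2)
      (by simp [h1]) (fun t => (hp _ (h3 _ _)).1) ode (hα u hu) (hβ _ _ hx hu) (hβ _ _ hu hu) ?_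
    · simp only [one_smul] at this
      exact this
    · intro t ht
      have ht' : ‖t • u‖ ≤ L * ε := by
        rw [norm_smul, Real.norm_eq_abs, abs_of_nonneg ht.1]
        nlinarith [ht.2, ht.1, norm_nonneg u]
      have hy : ‖x + t • u - z‖ ≤ 2 * L * ε := by
        have e : x + t • u - z = (x - z) + t • u := by abel
        rw [e]
        refine (norm_add_le _ _).trans ?_
        linarith
      have hd := hr (y := x + t • u) (by rw [dist_eq_norm]; nlinarith)
      have e : A (x + t • u) u - A z u - D (x - z) u - t • D u u =
          (A (x + t • u) - A z - D (x + t • u - z)) u := by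
        have : x + t • u - z = (x - z) + t • u := by abel
        rw [this]
        simp only [map_add, map_smul, sub_apply,
          add_apply, smul_apply]
        abel
      rw [e]
      calc _ ≤ ‖A (x + t • u) - A z - D (x + t • u - z)‖ * ‖u‖ :=
            ContinuousLinearMap.le_opNorm _ _
        _ ≤ (κ * (2 * L * ε)) * (L * ε) := by
            gcongr
            exact hd.trans (by gcongr)
        _ = κ * (2 * L * L) * ε^2 := by ring
        _ ≤ θ * ε^2 := by
            gcongr
            rw [hκ, div_mul_eq_mul_div, div_le_iff₀ (by positivity)]
            nlinarith
  have E1 := edge x u1 s1 b1 b3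
  have E2 := edge (x + u1) u2 s2 b2 b4
  have E3 := edge x (u1 + u2) (by rwa [← add_assoc]) b1 b5
  rw [map_add (A z) u1 u2, ← add_assoc] at E3
  have F := st_prod (hp _ (h3 _ _)).2 (hα u1 b3) (hβ _ _ b1 b3) (hβ _ _ b3 b3) E2.1 E2.2.1
    E1.2.2 E2.2.2 E3.2.2
  refine F.trans ?_
  have eX : D (x - z) u1 + D (x + u1 - z) u2 - D (x - z) (u1 + u2) +
      (1/2:ℝ) • (D u1 u1 + D u2 u2 - D (u1 + u2) (u1 + u2)) +
      (1/2:ℝ) • (A z u1 * A z u2 - A z u2 * A z u1) =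
      (1/2:ℝ) • (D u1 u2 - D u2 u1 + A z u1 * A z u2 - A z u2 * A z u1) := by
    have : x + u1 - z = (x - z) + u1 := by abel
    rw [this]
    simp only [map_add, add_apply]
    module
  rw [eX, norm_smul]
  have hθ1 : θ ≤ 1 := min_le_left _ _
  have hθ2 : θ ≤ δ / 6 := min_le_right _ _
  have n2 : ‖(1/2:ℝ)‖ = 1/2 := by norm_num
  rw [n2]
  have := st_num hK1 hθ0.le hθ1 hθ2 hε hε1 hε2
  linarith

end StokesGeom


section StokesTri

variable {M : Type*} [NormedRing M] [NormedAlgebra ℝ M] [StarRing M] [CStarRing M]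
  [StarModule ℝ M] {E : Type*} [NormedAddCommGroup E] [NormedSpace ℝ E]

theorem st_subdiv {A : E → E →L[ℝ] M} {P : E → E → M} {U S : Set E} (h : StPT A P U)
    (hS : Convex ℝ S) (hSU : S ⊆ U) {a b c p q r : E} (ha : a ∈ S) (hb : b ∈ S) (hc : c ∈ S)
    (hp : p = a + (1/2:ℝ) • (b - a)) (hq : q = b + (1/2:ℝ) • (c - b))
    (hr : r = c + (1/2:ℝ) • (a - c)) :
    ‖P a b * P b c * P c a - 1‖ ≤ ‖P a p * P p r * P r a - 1‖ + ‖P p b * P b q * P q p - 1‖ +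
      ‖P r q * P q c * P c r - 1‖ + ‖P q r * P r p * P p q - 1‖ := by
  have seg : ∀ {x y}, x ∈ S → y ∈ S → segment ℝ x y ⊆ U :=
    fun hx hy => (hS.segment_subset hx hy).trans hSU
  have mid : ∀ {x y m}, x ∈ S → y ∈ S → m = x + (1/2:ℝ) • (y - x) → m ∈ S := by
    intro x y m hx hy hm
    apply hS.segment_subset hx hy
    rw [segment_eq_image']
    exact ⟨1/2, by norm_num, hm.symm⟩
  have pS := mid ha hb hp
  have qS := mid hb hc hq
  have rS := mid hc ha hr
  have hu := h.2.2
  set T2 := P p b * P b q * P q p with hT2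
  set T3 := P r q * P q c * P c r with hT3
  set T4 := P q r * P r p * P p q with hT4
  have uT3 : T3 ∈ unitary M := mul_mem (mul_mem (hu _ _) (hu _ _)) (hu _ _)
  have uT4 : T4 ∈ unitary M := mul_mem (mul_mem (hu _ _) (hu _ _)) (hu _ _)
  have ab := st_mid h (seg ha hb) hp
  have bc := st_mid h (seg hb hc) hq
  have ca := st_mid h (seg hc ha) hr
  have pq := st_inv h (seg pS qS)
  have qp := st_inv h (seg qS pS)
  have qr := st_inv h (seg qS rS)
  have rp := st_inv h (seg rS pS)
  have e2 : P p b * P b q = T2 * P p q := by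
    rw [hT2, mul_assoc _ (P q p), qp, mul_one]
  have e3 : P q c * P c r = P q r * T3 := by
    rw [hT3]
    simp only [← mul_assoc]
    rw [qr, one_mul]
  have e4 : P q r = T4 * P q p * P p r := by
    rw [hT4, mul_assoc _ (P p q) (P q p), pq, mul_one, mul_assoc, rp, mul_one]
  have eH : P a b * P b c * P c a = P a p * T2 * P p q * T4 * P q p * P p r * T3 * P r a := by
    calc P a b * P b c * P c a = P a p * (P p b * P b q) * (P q c * P c r) * P r a := by
          rw [ab, bc, ca]; noncomm_ring
      _ = _ := by rw [e2, e3, e4]; noncomm_ring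
  have e5 : P a b * P b c * P c a - 1 =
      P a p * ((T2 - 1) * (P p q * T4 * P q p * P p r * T3 * P r a)) +
      (P a p * P p q) * ((T4 - 1) * (P q p * P p r * T3 * P r a)) +
      (P a p * P p r) * ((T3 - 1) * P r a) + (P a p * P p r * P r a - 1) := by
    rw [eH]
    have : P a p * P p r * T3 * P r a = P a p * (P p q * P q p) * P p r * T3 * P r a := by
      rw [pq, mul_one]
    have e6 : (P a p * P p r) * ((T3 - 1) * P r a) =
      P a p * (P p q * P q p) * P p r * T3 * P r a - P a p * P p r * P r a := by
      rw [← this]; noncomm_ring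
    rw [e6]
    noncomm_ring
  have nn : ∀ {x y : M} (t : M), x ∈ unitary M → y ∈ unitary M → ‖x * (t * y)‖ = ‖t‖ := by
    intro x y t hx hy
    rw [CStarRing.norm_mem_unitary_mul _ hx, CStarRing.norm_mul_mem_unitary _ hy]
  rw [e5]
  have t1 : ‖P a p * ((T2 - 1) * (P p q * T4 * P q p * P p r * T3 * P r a))‖ = ‖T2 - 1‖ :=
    nn _ (hu _ _) (mul_mem (mul_mem (mul_mem (mul_mem (mul_mem (hu _ _) uT4) (hu _ _)) (hu _ _))
      uT3) (hu _ _))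
  have t2 : ‖(P a p * P p q) * ((T4 - 1) * (P q p * P p r * T3 * P r a))‖ = ‖T4 - 1‖ :=
    nn _ (mul_mem (hu _ _) (hu _ _)) (mul_mem (mul_mem (mul_mem (hu _ _) (hu _ _)) uT3) (hu _ _))
  have t3 : ‖(P a p * P p r) * ((T3 - 1) * P r a)‖ = ‖T3 - 1‖ :=
    nn _ (mul_mem (hu _ _) (hu _ _)) (hu _ _)
  refine (norm_add_le _ _).trans ?_
  have := norm_add₃_le (a := P a p * ((T2 - 1) * (P p q * T4 * P q p * P p r * T3 * P r a)))
    (b := (P a p * P p q) * ((T4 - 1) * (P q p * P p r * T3 * P r a)))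
    (c := (P a p * P p r) * ((T3 - 1) * P r a))
  linarith

/-- affine chart of a scaled triangle -/
def stPhi (v w a : E) (l : ℝ) (q : EuclideanSpace ℝ (Fin 2)) : E :=
  a + l • (q 0 • v + q 1 • w)

/-- standard closed triangle -/
def stTri : Set (EuclideanSpace ℝ (Fin 2)) := {q | 0 ≤ q 0 ∧ 0 ≤ q 1 ∧ q 0 + q 1 ≤ 1}

/-- scaled closed triangle -/
def stT (v w a : E) (l : ℝ) : Set E := stPhi v w a l '' stTri

theorem stTri_compact : IsCompact stTri := by
  apply Metric.isCompact_of_isClosed_isBounded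
  · have c0 : Continuous fun q : EuclideanSpace ℝ (Fin 2) => q 0 := by fun_prop
    have c1 : Continuous fun q : EuclideanSpace ℝ (Fin 2) => q 1 := by fun_prop
    exact (isClosed_le continuous_const c0).inter ((isClosed_le continuous_const c1).inter
      (isClosed_le (c0.add c1) continuous_const))
  · refine (Metric.isBounded_closedBall (x := (0:EuclideanSpace ℝ (Fin 2))) (r := 1)).subset ?_
    rintro q ⟨h0, h1, h2⟩
    rw [mem_closedBall_zero_iff, EuclideanSpace.norm_eq, Real.sqrt_le_iff]
    refine ⟨by norm_num, ?_⟩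
    simp [Fin.sum_univ_two]
    nlinarith

theorem stPhi_cont (v w a : E) (l : ℝ) : Continuous (stPhi v w a l) := by
  unfold stPhi
  fun_prop

theorem stT_compact (v w a : E) (l : ℝ) : IsCompact (stT v w a l) :=
  stTri_compact.image (stPhi_cont v w a l)

theorem stTri_convex : Convex ℝ stTri := by
  rintro x ⟨x0, x1, x2⟩ y ⟨y0, y1, y2⟩ s t hs ht hst
  refine ⟨?_, ?_, ?_⟩
  · simp; positivity
  · simp; positivity
  · simp
    nlinarith

theorem stT_convex (v w a : E) (l : ℝ) : Convex ℝ (stT v w a l) := by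
  rintro _ ⟨x, hx, rfl⟩ _ ⟨y, hy, rfl⟩ s t hs ht hst
  refine ⟨s • x + t • y, stTri_convex hx hy hs ht hst, ?_⟩
  obtain rfl : t = 1 - s := by linarith
  simp [stPhi]
  module

theorem stT_mem (v w a : E) (l s t : ℝ) (hs : 0 ≤ s) (ht : 0 ≤ t) (hst : s + t ≤ 1) :
    a + l • (s • v + t • w) ∈ stT v w a l :=
  ⟨!₂[s, t], by simp [stTri, hs, ht, hst], by simp [stPhi]⟩

theorem stT_sub1 (v w a : E) (l : ℝ) : stT v w a (l/2) ⊆ stT v w a l := by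
  rintro _ ⟨q, ⟨h0, h1, h2⟩, rfl⟩
  have := stT_mem v w a l (q 0 / 2) (q 1 / 2) (by linarith) (by linarith) (by linarith)
  convert this using 1
  simp only [stPhi]; module

theorem stT_sub2 (v w a : E) (l : ℝ) : stT v w (a + (l/2) • v) (l/2) ⊆ stT v w a l := by
  rintro _ ⟨q, ⟨h0, h1, h2⟩, rfl⟩
  have := stT_mem v w a l (q 0 / 2 + 1/2) (q 1 / 2) (by linarith) (by linarith) (by linarith)
  convert this using 1
  simp only [stPhi]; module

theorem stT_sub3 (v w a : E) (l : ℝ) : stT v w (a + (l/2) • w) (l/2) ⊆ stT v w a l := by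
  rintro _ ⟨q, ⟨h0, h1, h2⟩, rfl⟩
  have := stT_mem v w a l (q 0 / 2) (q 1 / 2 + 1/2) (by linarith) (by linarith) (by linarith)
  convert this using 1
  simp only [stPhi]; module

theorem stT_sub4 (v w a : E) (l : ℝ) :
    stT v w (a + (l/2) • (v + w)) (-(l/2)) ⊆ stT v w a l := by
  rintro _ ⟨q, ⟨h0, h1, h2⟩, rfl⟩
  have := stT_mem v w a l (1/2 - q 0 / 2) (1/2 - q 1 / 2) (by linarith) (by linarith) (by linarith)
  convert this using 1
  simp only [stPhi]; module

theorem st_goursat (v w x0 : E) (k : E → ℝ → ℝ)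
    (hsub : ∀ a l, l ≠ 0 → stT v w a l ⊆ stT v w x0 1 → k a l ≤ k a (l/2) +
      k (a + (l/2) • v) (l/2) + k (a + (l/2) • w) (l/2) + k (a + (l/2) • (v + w)) (-(l/2)))
    (hloc : ∀ z ∈ stT v w x0 1, ∀ δ > 0, ∃ r > 0, ∀ a l, l ≠ 0 → |l| < r → z ∈ stT v w a l →
      stT v w a l ⊆ stT v w x0 1 → k a l ≤ δ * l^2) : k x0 1 ≤ 0 := by
  by_contra! hk
  set δ := k x0 1 with hδ
  let X := {p : E × ℝ // p.2 ≠ 0 ∧ stT v w p.1 p.2 ⊆ stT v w x0 1 ∧ δ * p.2^2 ≤ k p.1 p.2}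
  have step : ∀ p : X, ∃ p' : X, |p'.1.2| = |p.1.2| / 2 ∧
      stT v w p'.1.1 p'.1.2 ⊆ stT v w p.1.1 p.1.2 := by
    rintro ⟨⟨a, l⟩, hl, hT, hkl⟩
    simp only at hl hT hkl ⊢
    have hs := hsub a l hl hT
    have l2 : l/2 ≠ 0 := by simpa using hl
    have l2' : -(l/2) ≠ 0 := by simpa using hl
    have abs1 : |l/2| = |l|/2 := by rw [abs_div]; norm_num
    have abs2 : |-(l/2)| = |l|/2 := by rw [abs_neg, abs1]
    by_cases c1 : δ * (l/2)^2 ≤ k a (l/2)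
    · exact ⟨⟨(a, l/2), l2, (stT_sub1 v w a l).trans hT, c1⟩, abs1, stT_sub1 v w a l⟩
    by_cases c2 : δ * (l/2)^2 ≤ k (a + (l/2) • v) (l/2)
    · exact ⟨⟨(_, l/2), l2, (stT_sub2 v w a l).trans hT, c2⟩, abs1, stT_sub2 v w a l⟩
    by_cases c3 : δ * (l/2)^2 ≤ k (a + (l/2) • w) (l/2)
    · exact ⟨⟨(_, l/2), l2, (stT_sub3 v w a l).trans hT, c3⟩, abs1, stT_sub3 v w a l⟩
    by_cases c4 : δ * (-(l/2))^2 ≤ k (a + (l/2) • (v + w)) (-(l/2))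
    · exact ⟨⟨(_, -(l/2)), l2', (stT_sub4 v w a l).trans hT, c4⟩, abs2, stT_sub4 v w a l⟩
    exfalso
    push Not at c1 c2 c3 c4
    nlinarith
  choose F hF1 hF2 using step
  let p0 : X := ⟨(x0, 1), one_ne_zero, subset_rfl, by simp [hδ]⟩
  let p : ℕ → X := fun n => F^[n] p0
  have hp : ∀ n, p (n+1) = F (p n) := fun n => Function.iterate_succ_apply' F n p0
  have habs : ∀ n, |(p n).1.2| = (1/2)^n := by
    intro n
    induction n with
    | zero => simp [p, p0]
    | succ n ih => rw [hp, hF1, ih]; ring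
  obtain ⟨z, hz⟩ := IsCompact.nonempty_iInter_of_sequence_nonempty_isCompact_isClosed
    (fun n => stT v w (p n).1.1 (p n).1.2) (fun n => by simp only [hp]; exact hF2 _)
    (fun n => ⟨_, stT_mem v w _ _ 0 0 le_rfl le_rfl (by norm_num)⟩)
    (stT_compact _ _ _ _) (fun n => (stT_compact _ _ _ _).isClosed)
  rw [Set.mem_iInter] at hz
  obtain ⟨r, hr, H⟩ := hloc z ((p 0).2.2.1 (hz 0)) (δ/2) (by positivity)
  obtain ⟨n, hn⟩ := exists_pow_lt_of_lt_one hr (by norm_num : (1/2:ℝ) < 1)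
  have h1 := H _ _ (p n).2.1 (by rw [habs]; exact hn) (hz n) (p n).2.2.1
  have h2 := (p n).2.2.2
  have h3 : 0 < (p n).1.2^2 := by
    have := (p n).2.1
    positivity
  nlinarith

/-- holonomy defect of a scaled triangle -/
def stH (P : E → E → M) (v w a : E) (l : ℝ) : ℝ :=
  ‖P a (a + l • v) * P (a + l • v) (a + l • w) * P (a + l • w) a - 1‖

theorem stH_sub {A : E → E →L[ℝ] M} {P : E → E → M} {U : Set E} (h : StPT A P U)
    (v w a : E) (l : ℝ) (hU : stT v w a l ⊆ U) :
    stH P v w a l ≤ stH P v w a (l/2) + stH P v w (a + (l/2) • v) (l/2) +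
      stH P v w (a + (l/2) • w) (l/2) + stH P v w (a + (l/2) • (v + w)) (-(l/2)) := by
  have m0 := stT_mem v w a l 0 0 (by norm_num) (by norm_num) (by norm_num)
  have m1 := stT_mem v w a l 1 0 (by norm_num) (by norm_num) (by norm_num)
  have m2 := stT_mem v w a l 0 1 (by norm_num) (by norm_num) (by norm_num)
  simp only [zero_smul, one_smul, add_zero, zero_add, smul_zero] at m0 m1 m2
  have := st_subdiv h (stT_convex v w a l) hU m0 m1 m2 (p := a + (l/2) • v)
    (q := a + (l/2) • (v + w)) (r := a + (l/2) • w) (by module) (by module) (by module)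
  refine this.trans (le_of_eq ?_)
  unfold stH
  have e1 : a + (l/2) • v + (l/2) • v = a + l • v := by module
  have e2 : a + (l/2) • v + (l/2) • w = a + (l/2) • (v + w) := by module
  have e3 : a + (l/2) • w + (l/2) • v = a + (l/2) • (v + w) := by module
  have e4 : a + (l/2) • w + (l/2) • w = a + l • w := by module
  have e5 : a + (l/2) • (v + w) + (-(l/2)) • v = a + (l/2) • w := by module
  have e6 : a + (l/2) • (v + w) + (-(l/2)) • w = a + (l/2) • v := by module
  rw [e1, e2, e3, e4, e5, e6]

theorem stT_norm {v w a : E} {l : ℝ} {x y : E} (hx : x ∈ stT v w a l) (hy : y ∈ stT v w a l) :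
    ‖x - y‖ ≤ (2 * (‖v‖ + ‖w‖)) * |l| := by
  obtain ⟨p, ⟨p0, p1, p2⟩, rfl⟩ := hx
  obtain ⟨q, ⟨q0, q1, q2⟩, rfl⟩ := hy
  have e : stPhi v w a l p - stPhi v w a l q = l • ((p 0 - q 0) • v + (p 1 - q 1) • w) := by
    simp only [stPhi]; module
  rw [e, norm_smul, mul_comm, Real.norm_eq_abs]
  gcongr
  refine (norm_add_le _ _).trans ?_
  rw [norm_smul, norm_smul, Real.norm_eq_abs, Real.norm_eq_abs]
  have h1 : |p 0 - q 0| ≤ 1 := abs_le.2 ⟨by linarith, by linarith⟩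
  have h2 : |p 1 - q 1| ≤ 1 := abs_le.2 ⟨by linarith, by linarith⟩
  nlinarith [norm_nonneg v, norm_nonneg w]

theorem stH_local {A : E → E →L[ℝ] M} {P : E → E → M} {U : Set E} (h : StPT A P U) {z : E}
    (v w : E) {D : E →L[ℝ] E →L[ℝ] M} (hA : HasFDerivAt A D z) (δ : ℝ) (hδ : 0 < δ) :
    ∃ r > 0, ∀ (a : E) (l : ℝ), l ≠ 0 → |l| < r → z ∈ stT v w a l → stT v w a l ⊆ U →
      stH P v w a l ≤ l^2 *
        (1/2 * ‖D v w - D w v + A z v * A z w - A z w * A z v‖ + δ) := by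
  obtain ⟨r, hr, H⟩ := st_local h hA (2 * (‖v‖ + ‖w‖)) (by positivity) δ hδ
  refine ⟨r, hr, ?_⟩
  intro a l hl hlr hz hU
  have m0 := stT_mem v w a l 0 0 (by norm_num) (by norm_num) (by norm_num)
  have m1 := stT_mem v w a l 1 0 (by norm_num) (by norm_num) (by norm_num)
  have m2 := stT_mem v w a l 0 1 (by norm_num) (by norm_num) (by norm_num)
  simp only [zero_smul, one_smul, add_zero, zero_add, smul_zero] at m0 m1 m2
  have seg : ∀ {x y}, x ∈ stT v w a l → y ∈ stT v w a l → segment ℝ x y ⊆ U :=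
    fun hx hy => ((stT_convex v w a l).segment_subset hx hy).trans hU
  have e1 : a + l • v + l • (w - v) = a + l • w := by module
  have e2 : l • v + l • (w - v) = l • w := by module
  have n1 := stT_norm m1 m0
  have n2 := stT_norm m2 m1
  have n3 := stT_norm m2 m0
  rw [add_sub_cancel_left] at n1 n3
  rw [show a + l • w - (a + l • v) = l • (w - v) by module] at n2
  have K := H a (l • v) (l • (w - v)) |l| (abs_pos.2 hl) hlr
  rw [e1, e2] at K
  have K' := K (seg m0 m1) (seg m1 m2) (seg m0 m2) (stT_norm m0 hz) (stT_norm m1 hz) n1 n2 n3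
  have inv := st_inv h (seg m0 m2)
  have eH : stH P v w a l = ‖P a (a + l • v) * P (a + l • v) (a + l • w) - P a (a + l • w)‖ := by
    unfold stH
    rw [← inv, ← sub_mul, CStarRing.norm_mul_mem_unitary _ (h.2.2 _ _)]
  rw [eH]
  refine K'.trans (le_of_eq ?_)
  have eF : D (l • v) (l • (w - v)) - D (l • (w - v)) (l • v) +
      A z (l • v) * A z (l • (w - v)) - A z (l • (w - v)) * A z (l • v) =
      (l^2) • (D v w - D w v + A z v * A z w - A z w * A z v) := by
    simp only [map_smul, map_sub, smul_apply, sub_apply, smul_mul_assoc, mul_smul_comm, mul_sub,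
      sub_mul]
    module
  rw [eF, norm_smul, sq_abs, Real.norm_eq_abs, abs_of_nonneg (sq_nonneg l)]
  ring

end StokesTri


section StokesCurv

theorem st_aux_norm {W E : Type*} [NormedAddCommGroup W] [NormedSpace ℝ W]
    [NormedAddCommGroup E] [NormedSpace ℝ E] (D : E →L[ℝ] E →L[ℝ] W) : ‖D - 0‖ = ‖D‖ := by
  rw [sub_zero]

theorem st_aux0 {V E : Type*} [NormedAddCommGroup V] [TopologicalSpace E] (f : E → V)
    {U : Set E} {z0 : E} (h : ContinuousWithinAt f U z0) :
    Filter.Tendsto (fun z => ‖f z - f z0‖) (nhdsWithin z0 U) (nhds 0) :=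
  tendsto_iff_norm_sub_tendsto_zero.1 (show Filter.Tendsto f (nhdsWithin z0 U) (nhds (f z0)) from h)

theorem st_aux_tendsto {W E : Type*} [NormedAddCommGroup W] [NormedSpace ℝ W]
    [NormedAddCommGroup E] [NormedSpace ℝ E] (f : E → E →L[ℝ] E →L[ℝ] W) {U : Set E} {z0 : E}
    (h : ContinuousWithinAt f U z0) :
    Filter.Tendsto (fun z => ‖f z - f z0‖) (nhdsWithin z0 U) (nhds 0) := by
  exact st_aux0 (V := E →L[ℝ] E →L[ℝ] W) f h

theorem st_form_bound {M E : Type*} [NormedRing M] [NormedAlgebra ℝ M]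
    [NormedAddCommGroup E] [NormedSpace ℝ E] (D D' : E →L[ℝ] E →L[ℝ] M) (a a' : E →L[ℝ] M)
    (v w : E) (hv : ‖v‖ = 1) (hw : ‖w‖ = 1) :
    ‖D v w - D w v + a v * a w - a w * a v‖ ≤ ‖D' v w - D' w v + a' v * a' w - a' w * a' v‖ +
      (2 * ‖D - D'‖ + 2 * (‖a‖ + ‖a'‖) * ‖a - a'‖) := by
  have e : D v w - D w v + a v * a w - a w * a v =
      (D' v w - D' w v + a' v * a' w - a' w * a' v) + (((D - D') v w - (D - D') w v) +
      ((a v * (a - a') w + (a - a') v * a' w) - (a w * (a - a') v + (a - a') w * a' v))) := by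
    simp only [sub_apply]
    noncomm_ring
  have hD : ∀ x y : E, ‖x‖ = 1 → ‖y‖ = 1 → ‖(D - D') x y‖ ≤ ‖D - D'‖ := by
    intro x y hx hy
    simpa [hx, hy] using (D - D').le_opNorm₂ x y
  have ha : ∀ (b : E →L[ℝ] M) (x : E), ‖x‖ = 1 → ‖b x‖ ≤ ‖b‖ := by
    intro b x hx
    simpa [hx] using b.le_opNorm x
  have hm : ∀ (b c : E →L[ℝ] M) (x y : E), ‖x‖ = 1 → ‖y‖ = 1 → ‖b x * c y‖ ≤ ‖b‖ * ‖c‖ := by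
    intro b c x y hx hy
    exact (norm_mul_le _ _).trans
      (mul_le_mul (ha b x hx) (ha c y hy) (norm_nonneg _) (norm_nonneg _))
  rw [e]
  refine (norm_add_le _ _).trans ?_
  gcongr
  refine (norm_add_le _ _).trans ?_
  have i1 := norm_sub_le ((D - D') v w) ((D - D') w v)
  have i2 := norm_sub_le (a v * (a - a') w + (a - a') v * a' w)
    (a w * (a - a') v + (a - a') w * a' v)
  have i3 := norm_add_le (a v * (a - a') w) ((a - a') v * a' w)
  have i4 := norm_add_le (a w * (a - a') v) ((a - a') w * a' v)
  have j1 := hm a (a - a') v w hv hw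
  have j2 := hm (a - a') a' v w hv hw
  have j3 := hm a (a - a') w v hw hv
  have j4 := hm (a - a') a' w v hw hv
  linarith [hD v w hv hw, hD w v hw hv]

variable {M E : Type*} [NormedRing M] [NormedAlgebra ℝ M]
    [NormedAddCommGroup E] [NormedSpace ℝ E]

/-- generic version of curvNorm -/
noncomputable def stCurv (A : E → (E →L[ℝ] M)) (z : E) : ℝ :=
  ⨆ v : Metric.sphere (0 : E) 1, ⨆ w : Metric.sphere (0 : E) 1,
      ‖fderiv ℝ A z v w - fderiv ℝ A z w v
        + A z v * A z w - A z w * A z v‖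

theorem st_curv_nonneg (A : E → E →L[ℝ] M)
    (z : E) : 0 ≤ stCurv A z :=
  Real.iSup_nonneg fun _ => Real.iSup_nonneg fun _ => norm_nonneg _

theorem st_le_curv (A : E → E →L[ℝ] M)
    (z v w : E) (hv : ‖v‖ = 1) (hw : ‖w‖ = 1) :
    ‖fderiv ℝ A z v w - fderiv ℝ A z w v + A z v * A z w - A z w * A z v‖ ≤
      stCurv A z := by
  set B := 2 * ‖fderiv ℝ A z‖ + 2 * (‖A z‖) * ‖A z‖ with hB
  have hB0 : 0 ≤ B := by positivity
  have hb : ∀ v w : E, ‖v‖ = 1 → ‖w‖ = 1 →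
      ‖fderiv ℝ A z v w - fderiv ℝ A z w v + A z v * A z w - A z w * A z v‖ ≤ B := by
    intro v w hv hw
    have := st_form_bound (fderiv ℝ A z) 0 (A z) 0 v w hv hw
    have e0 : ‖fderiv ℝ A z - 0‖ = ‖fderiv ℝ A z‖ := st_aux_norm (W := M) _
    rw [e0] at this
    simpa [hB] using this
  have hs : ∀ x : Metric.sphere (0 : E) 1, ‖(x : E)‖ = 1 :=
    fun x => mem_sphere_zero_iff_norm.1 x.2
  let v' : Metric.sphere (0 : E) 1 := ⟨v, mem_sphere_zero_iff_norm.2 hv⟩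
  let w' : Metric.sphere (0 : E) 1 := ⟨w, mem_sphere_zero_iff_norm.2 hw⟩
  unfold stCurv
  refine le_trans ?_ (le_ciSup (f := fun v : Metric.sphere (0 : E) 1 =>
    ⨆ w : Metric.sphere (0 : E) 1,
      ‖fderiv ℝ A z v w - fderiv ℝ A z w v
        + A z v * A z w - A z w * A z v‖) ?_ v')
  · refine le_ciSup (f := fun w : Metric.sphere (0 : E) 1 =>
      ‖fderiv ℝ A z v w - fderiv ℝ A z w v
        + A z v * A z w - A z w * A z v‖) ?_ w'
    refine ⟨B, ?_⟩
    rintro _ ⟨x, rfl⟩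
    exact hb _ _ hv (hs x)
  · refine ⟨B, ?_⟩
    rintro _ ⟨x, rfl⟩
    exact Real.iSup_le (fun y => hb _ _ (hs x) (hs y)) hB0

theorem st_curv_cont (A : E → E →L[ℝ] M)
    {U : Set (E)} (hU : IsOpen U) (hA : ContDiffOn ℝ (⊤ : ℕ∞) A U) :
    ContinuousOn (stCurv A) U := by
  have hD : ContinuousOn (fderiv ℝ A) U :=
    hA.continuousOn_fderiv_of_isOpen hU (by exact_mod_cast le_top)
  have hs : ∀ x : Metric.sphere (0 : E) 1, ‖(x : E)‖ = 1 :=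
    fun x => mem_sphere_zero_iff_norm.1 x.2
  have key : ∀ z z', stCurv A z ≤ stCurv A z' +
      (2 * ‖fderiv ℝ A z - fderiv ℝ A z'‖ + 2 * (‖A z‖ + ‖A z'‖) * ‖A z - A z'‖) := by
    intro z z'
    have h0 := st_curv_nonneg A z'
    refine Real.iSup_le (fun x => Real.iSup_le (fun y => ?_) (by positivity)) (by positivity)
    refine (st_form_bound _ (fderiv ℝ A z') _ (A z') _ _ (hs x) (hs y)).trans ?_
    gcongr
    exact st_le_curv A z' x y (hs x) (hs y)
  intro z0 hz0
  have hAc := hA.continuousOn z0 hz0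
  have hDc := hD z0 hz0
  have lim : Filter.Tendsto (fun z => 2 * ‖fderiv ℝ A z - fderiv ℝ A z0‖ +
      2 * (‖A z‖ + ‖A z0‖) * ‖A z - A z0‖) (nhdsWithin z0 U) (nhds 0) := by
    have t1 : Filter.Tendsto (fun z => ‖fderiv ℝ A z - fderiv ℝ A z0‖)
        (nhdsWithin z0 U) (nhds 0) := st_aux_tendsto (W := M) (fderiv ℝ A) hDc
    have : ContinuousWithinAt (fun z => 2 * (‖A z‖ + ‖A z0‖) * ‖A z - A z0‖) U z0 :=
      (((hAc.norm.add continuousWithinAt_const).const_mul 2).mul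
          (hAc.sub continuousWithinAt_const).norm)
    have t2 : Filter.Tendsto (fun z => 2 * (‖A z‖ + ‖A z0‖) * ‖A z - A z0‖)
        (nhdsWithin z0 U) (nhds 0) := by
      have h2 := this.tendsto
      rw [sub_self, norm_zero, mul_zero] at h2
      exact h2
    have := (t1.const_mul 2).add t2
    rw [mul_zero, add_zero] at this
    exact this
  rw [ContinuousWithinAt, tendsto_iff_dist_tendsto_zero]
  refine squeeze_zero (fun _ => dist_nonneg) (fun z => ?_) lim
  rw [Real.dist_eq, abs_le]
  have k1 := key z z0
  have k2 := key z0 z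
  rw [norm_sub_rev (fderiv ℝ A z0), norm_sub_rev (A z0), add_comm ‖A z0‖] at k2
  constructor <;> linarith

end StokesCurv

section StokesMeas

variable {n : ℕ}

/-- standard open triangle -/
def stO : Set (EuclideanSpace ℝ (Fin 2)) := {q | 0 < q 0 ∧ 0 < q 1 ∧ q 0 + q 1 < 1}

theorem stO_open : IsOpen stO := by
  have c0 : Continuous fun q : EuclideanSpace ℝ (Fin 2) => q 0 := by fun_prop
  have c1 : Continuous fun q : EuclideanSpace ℝ (Fin 2) => q 1 := by fun_prop
  exact (isOpen_lt continuous_const c0).inter ((isOpen_lt continuous_const c1).inter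
      (isOpen_lt (c0.add c1) continuous_const))

theorem stO_sub : stO ⊆ stTri := fun _ h => ⟨h.1.le, h.2.1.le, h.2.2.le⟩

theorem st_haar : (Measure.hausdorffMeasure (2:ℝ) :
    Measure (EuclideanSpace ℝ (Fin 2))).IsAddHaarMeasure := by
  have := isAddHaarMeasure_hausdorffMeasure (E := EuclideanSpace ℝ (Fin 2))
  simpa using this

theorem stTri_fin : (Measure.hausdorffMeasure (2:ℝ) :
    Measure (EuclideanSpace ℝ (Fin 2))) stTri < ⊤ := by
  have := st_haar
  exact stTri_compact.measure_lt_top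

theorem stO_pos : 0 < (Measure.hausdorffMeasure (2:ℝ) :
    Measure (EuclideanSpace ℝ (Fin 2))).real stO := by
  have := st_haar
  have h1 : 0 < (Measure.hausdorffMeasure (2:ℝ) :
    Measure (EuclideanSpace ℝ (Fin 2))) stO := by
    refine stO_open.measure_pos _ ⟨!₂[1/4, 1/4], ?_⟩
    simp [stO]; norm_num
  exact ENNReal.toReal_pos h1.ne' ((measure_mono stO_sub).trans_lt stTri_fin).ne

theorem st_image_measure {e1 e2 v w : EuclideanSpace ℝ (Fin n)} {α β γ : ℝ}
    (h1 : ‖e1‖ = 1) (h2 : ‖e2‖ = 1) (h12 : inner ℝ e1 e2 = (0:ℝ)) (hv : v = α • e1)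
    (hw : w = β • e1 + γ • e2) (a : EuclideanSpace ℝ (Fin n)) (l : ℝ)
    (S : Set (EuclideanSpace ℝ (Fin 2))) :
    (Measure.hausdorffMeasure (2:ℝ)) (stPhi v w a l '' S) =
      ENNReal.ofReal (l^2 * |α * γ|) * Measure.hausdorffMeasure (2:ℝ) S := by
  have := st_haar
  let L : EuclideanSpace ℝ (Fin 2) →ₗ[ℝ] EuclideanSpace ℝ (Fin 2) :=
    Matrix.toLpLin 2 2 (!![l * α, l * β; 0, l * γ])
  let j : EuclideanSpace ℝ (Fin 2) → EuclideanSpace ℝ (Fin n) :=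
    fun q => a + (q 0 • e1 + q 1 • e2)
  have hj : Isometry j := by
    apply Isometry.of_dist_eq
    intro p q
    rw [dist_eq_norm, dist_eq_norm]
    have e : j p - j q = (p 0 - q 0) • e1 + (p 1 - q 1) • e2 := by simp only [j]; module
    rw [e, EuclideanSpace.norm_eq (p - q), ← Real.sqrt_sq (norm_nonneg ((p 0 - q 0) • e1 + _))]
    congr 1
    rw [norm_add_sq_real, inner_smul_left, inner_smul_right, h12, norm_smul, norm_smul, h1, h2]
    simp [Fin.sum_univ_two]
  have hc : stPhi v w a l '' S = j '' (L '' S) := by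
    rw [Set.image_image]
    apply Set.image_congr
    intro q _
    have l0 : L q 0 = l * α * q 0 + l * β * q 1 := by
      simp [L, Matrix.toLpLin_apply, dotProduct, Fin.sum_univ_two]
    have l1 : L q 1 = l * γ * q 1 := by
      simp [L, Matrix.toLpLin_apply, dotProduct, Fin.sum_univ_two]
    simp only [j, l0, l1, stPhi, hv, hw]
    module
  rw [hc, hj.hausdorffMeasure_image (Or.inl (by norm_num)), Measure.addHaar_image_linearMap]
  have hdet : LinearMap.det L = l^2 * (α * γ) := by
    simp only [L]
    rw [LinearMap.det_toLpLin, Matrix.det_fin_two_of]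
    ring
  rw [hdet, abs_mul, abs_of_nonneg (sq_nonneg l)]

theorem stPhi_inj {e1 e2 v w : EuclideanSpace ℝ (Fin n)} {α β γ : ℝ}
    (h1 : ‖e1‖ = 1) (h2 : ‖e2‖ = 1) (h12 : inner ℝ e1 e2 = (0:ℝ)) (hv : v = α • e1)
    (hw : w = β • e1 + γ • e2) (hα : α ≠ 0) (hγ : γ ≠ 0) (a : EuclideanSpace ℝ (Fin n)) (l : ℝ)
    (hl : l ≠ 0) : Function.Injective (stPhi v w a l) := by
  intro p q hpq
  have e : l • (((p 0 - q 0) * α + (p 1 - q 1) * β) • e1 + ((p 1 - q 1) * γ) • e2) = 0 := by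
    have : stPhi v w a l p - stPhi v w a l q = 0 := sub_eq_zero.2 hpq
    rw [← this]
    simp only [stPhi, hv, hw]; module
  have e' := (smul_eq_zero.1 e).resolve_left hl
  have h21 : inner ℝ e2 e1 = (0:ℝ) := by rw [real_inner_comm]; exact h12
  have i2 := congrArg (fun x => inner ℝ e2 x) e'
  have i1 := congrArg (fun x => inner ℝ e1 x) e'
  simp only [inner_add_right, inner_smul_right, h12, h21, real_inner_self_eq_norm_sq, h1, h2,
    inner_zero_right] at i1 i2
  have k1 : p 1 - q 1 = 0 := by
    have : (p 1 - q 1) * γ = 0 := by linarith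
    exact (mul_eq_zero.1 this).resolve_right hγ
  have k0 : p 0 - q 0 = 0 := by
    rw [k1] at i1
    have : (p 0 - q 0) * α = 0 := by linarith
    exact (mul_eq_zero.1 this).resolve_right hα
  ext i
  fin_cases i
  · simpa using sub_eq_zero.1 k0
  · simpa using sub_eq_zero.1 k1

theorem st_superadd {X : Type*} [MeasurableSpace X] {μ : Measure X} {f : X → ℝ} (hf : ∀ x, 0 ≤ f x)
    {s s1 s2 s3 s4 : Set X} (hs : IntegrableOn f s μ)
    (m2 : MeasurableSet s2) (m3 : MeasurableSet s3)
    (m4 : MeasurableSet s4) (i1 : s1 ⊆ s) (i2 : s2 ⊆ s) (i3 : s3 ⊆ s) (i4 : s4 ⊆ s)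
    (d12 : Disjoint s1 s2) (d13 : Disjoint s1 s3) (d14 : Disjoint s1 s4) (d23 : Disjoint s2 s3)
    (d24 : Disjoint s2 s4) (d34 : Disjoint s3 s4) :
    ∫ x in s1, f x ∂μ + ∫ x in s2, f x ∂μ + ∫ x in s3, f x ∂μ + ∫ x in s4, f x ∂μ ≤
      ∫ x in s, f x ∂μ := by
  have u12 := Set.union_subset i1 i2
  have u123 := Set.union_subset u12 i3
  rw [← setIntegral_union d12 m2 (hs.mono_set i1) (hs.mono_set i2),
    ← setIntegral_union (Set.disjoint_union_left.2 ⟨d13, d23⟩) m3 (hs.mono_set u12)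
      (hs.mono_set i3),
    ← setIntegral_union (Set.disjoint_union_left.2 ⟨Set.disjoint_union_left.2 ⟨d14, d24⟩, d34⟩) m4
      (hs.mono_set u123) (hs.mono_set i4)]
  exact setIntegral_mono_set hs (Filter.Eventually.of_forall hf)
    (Set.union_subset u123 i4).eventuallyLE

/-- scaled open triangle -/
def stOT (v w a : EuclideanSpace ℝ (Fin n)) (l : ℝ) : Set (EuclideanSpace ℝ (Fin n)) :=
  stPhi v w a l '' stO

theorem stOT_superadd {e1 e2 v w : EuclideanSpace ℝ (Fin n)} {α β γ : ℝ}
    (h1 : ‖e1‖ = 1) (h2 : ‖e2‖ = 1) (h12 : inner ℝ e1 e2 = (0:ℝ)) (hv : v = α • e1)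
    (hw : w = β • e1 + γ • e2) (hα : α ≠ 0) (hγ : γ ≠ 0) (a : EuclideanSpace ℝ (Fin n)) (l : ℝ)
    (hl : l ≠ 0) {μ : Measure (EuclideanSpace ℝ (Fin n))} {f : EuclideanSpace ℝ (Fin n) → ℝ}
    (hf : ∀ x, 0 ≤ f x) (hi : IntegrableOn f (stT v w a l) μ) :
    ∫ x in stOT v w a (l/2), f x ∂μ + ∫ x in stOT v w (a + (l/2) • v) (l/2), f x ∂μ +
      ∫ x in stOT v w (a + (l/2) • w) (l/2), f x ∂μ +
      ∫ x in stOT v w (a + (l/2) • (v + w)) (-(l/2)), f x ∂μ ≤ ∫ x in stOT v w a l, f x ∂μ := by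
  have inj : ∀ a l, l ≠ 0 → Function.Injective (stPhi v w a l) :=
    fun a l hl => stPhi_inj h1 h2 h12 hv hw hα hγ a l hl
  have meas : ∀ a l, l ≠ 0 → MeasurableSet (stOT v w a l) := fun a l hl =>
    ((stPhi_cont v w a l).measurableEmbedding (inj a l hl)).measurableSet_image.2
      stO_open.measurableSet
  have l2 : l/2 ≠ 0 := by simpa using hl
  have l2' : -(l/2) ≠ 0 := by simpa using hl
  have s1 : stOT v w a (l/2) ⊆ stPhi v w a l '' {q | q ∈ stO ∧ q 0 + q 1 < 1/2} := by
    rintro _ ⟨q, ⟨h0, h1, h2⟩, rfl⟩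
    refine ⟨!₂[q 0 / 2, q 1 / 2], ⟨⟨?_, ?_, ?_⟩, ?_⟩, ?_⟩
    · simp; linarith
    · simp; linarith
    · simp; linarith
    · simp; linarith
    · simp [stPhi]; module
  have s2 : stOT v w (a + (l/2) • v) (l/2) ⊆ stPhi v w a l '' {q | q ∈ stO ∧ 1/2 < q 0} := by
    rintro _ ⟨q, ⟨h0, h1, h2⟩, rfl⟩
    refine ⟨!₂[q 0 / 2 + 1/2, q 1 / 2], ⟨⟨?_, ?_, ?_⟩, ?_⟩, ?_⟩
    · simp; linarith
    · simp; linarith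
    · simp; linarith
    · simp; linarith
    · simp [stPhi]; module
  have s3 : stOT v w (a + (l/2) • w) (l/2) ⊆ stPhi v w a l '' {q | q ∈ stO ∧ 1/2 < q 1} := by
    rintro _ ⟨q, ⟨h0, h1, h2⟩, rfl⟩
    refine ⟨!₂[q 0 / 2, q 1 / 2 + 1/2], ⟨⟨?_, ?_, ?_⟩, ?_⟩, ?_⟩
    · simp; linarith
    · simp; linarith
    · simp; linarith
    · simp; linarith
    · simp [stPhi]; module
  have s4 : stOT v w (a + (l/2) • (v + w)) (-(l/2)) ⊆
      stPhi v w a l '' {q | q ∈ stO ∧ q 0 < 1/2 ∧ q 1 < 1/2 ∧ 1/2 < q 0 + q 1} := by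
    rintro _ ⟨q, ⟨h0, h1, h2⟩, rfl⟩
    refine ⟨!₂[1/2 - q 0 / 2, 1/2 - q 1 / 2], ⟨⟨?_, ?_, ?_⟩, ?_, ?_, ?_⟩, ?_⟩
    · simp; linarith
    · simp; linarith
    · simp; linarith
    · simp; linarith
    · simp; linarith
    · simp; linarith
    · simp [stPhi]; module
  have dis : ∀ {S T S' T' : Set _}, S ⊆ stPhi v w a l '' S' → T ⊆ stPhi v w a l '' T' →
      (∀ q, q ∈ S' → q ∈ T' → False) → Disjoint S T := by
    intro S T S' T' hS hT hd
    refine Disjoint.mono hS hT ?_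
    rw [Set.disjoint_image_iff (inj a l hl)]
    exact Set.disjoint_left.2 hd
  have sub : ∀ {S : Set _} {p : EuclideanSpace ℝ (Fin 2) → Prop},
      S ⊆ stPhi v w a l '' {q | q ∈ stO ∧ p q} → S ⊆ stOT v w a l := by
    intro S p hS
    exact hS.trans (Set.image_mono fun q hq => hq.1)
  refine st_superadd hf (hi.mono_set (Set.image_mono stO_sub)) (meas _ _ l2) (meas _ _ l2)
    (meas _ _ l2') (sub s1) (sub s2) (sub s3) (sub s4) (dis s1 s2 ?_) (dis s1 s3 ?_) (dis s1 s4 ?_)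
    (dis s2 s3 ?_) (dis s2 s4 ?_) (dis s3 s4 ?_)
  all_goals
    rintro q ⟨⟨a0, a1, a2⟩, a3⟩ ⟨⟨b0, b1, b2⟩, b3⟩
    linarith

theorem st_curv_eq (n N : ℕ)
    (A : EuclideanSpace ℝ (Fin n) → (EuclideanSpace ℝ (Fin n) →L[ℝ] MatN N)) :
    curvNorm n N A = stCurv A := rfl

end StokesMeas


section StokesFinal

variable {M : Type*} [NormedRing M] [NormedAlgebra ℝ M] [StarRing M] [CStarRing M]
  [StarModule ℝ M] {n : ℕ}

theorem st_gs (v w : EuclideanSpace ℝ (Fin n)) :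
    (v = 0 ∨ ∃ c : ℝ, w = c • v) ∨ ∃ (e1 e2 : EuclideanSpace ℝ (Fin n)) (α β γ : ℝ), α ≠ 0 ∧ γ ≠ 0 ∧
      ‖e1‖ = 1 ∧ ‖e2‖ = 1 ∧ inner ℝ e1 e2 = (0:ℝ) ∧ v = α • e1 ∧ w = β • e1 + γ • e2 := by
  by_cases hv : v = 0
  · exact Or.inl (Or.inl hv)
  have hv' : ‖v‖ ≠ 0 := norm_ne_zero_iff.2 hv
  set e1 := ‖v‖⁻¹ • v with he1
  have hve : v = ‖v‖ • e1 := by rw [he1, smul_smul, mul_inv_cancel₀ hv', one_smul]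
  have n1 : ‖e1‖ = 1 := by rw [he1, norm_smul, norm_inv, norm_norm, inv_mul_cancel₀ hv']
  set β : ℝ := inner ℝ e1 w with hβ
  by_cases hw : w - β • e1 = 0
  · refine Or.inl (Or.inr ⟨β * ‖v‖⁻¹, ?_⟩)
    rw [mul_smul, ← he1]; exact sub_eq_zero.1 hw
  have hw' : ‖w - β • e1‖ ≠ 0 := norm_ne_zero_iff.2 hw
  refine Or.inr ⟨e1, ‖w - β • e1‖⁻¹ • (w - β • e1), ‖v‖, β, ‖w - β • e1‖, hv', hw', n1, ?_, ?_,
    hve, ?_⟩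
  · rw [norm_smul, norm_inv, norm_norm, inv_mul_cancel₀ hw']
  · rw [inner_smul_right, inner_sub_right, inner_smul_right, real_inner_self_eq_norm_sq, n1, ← hβ]
    ring
  · rw [smul_inv_smul₀ hw']; abel

theorem st_hull (x₀ x₁ x₂ : EuclideanSpace ℝ (Fin n)) :
    convexHull ℝ {x₀, x₁, x₂} = stT (x₁ - x₀) (x₂ - x₀) x₀ 1 := by
  apply Set.Subset.antisymm
  · refine convexHull_min ?_ (stT_convex _ _ _ _)
    have m0 := stT_mem (x₁ - x₀) (x₂ - x₀) x₀ 1 0 0 (by norm_num) (by norm_num) (by norm_num)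
    have m1 := stT_mem (x₁ - x₀) (x₂ - x₀) x₀ 1 1 0 (by norm_num) (by norm_num) (by norm_num)
    have m2 := stT_mem (x₁ - x₀) (x₂ - x₀) x₀ 1 0 1 (by norm_num) (by norm_num) (by norm_num)
    simp only [zero_smul, one_smul, add_zero, zero_add, add_sub_cancel] at m0 m1 m2
    rintro x (rfl | rfl | rfl)
    · exact m0
    · exact m1
    · exact m2
  · rintro _ ⟨q, ⟨h0, h1, h2⟩, rfl⟩
    have hc := convex_convexHull ℝ ({x₀, x₁, x₂} : Set (EuclideanSpace ℝ (Fin n)))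
    have s := subset_convexHull ℝ ({x₀, x₁, x₂} : Set (EuclideanSpace ℝ (Fin n)))
    have a0 : x₀ ∈ convexHull ℝ ({x₀, x₁, x₂} : Set (EuclideanSpace ℝ (Fin n))) := s (by simp)
    have a1 : x₁ ∈ convexHull ℝ ({x₀, x₁, x₂} : Set (EuclideanSpace ℝ (Fin n))) := s (by simp)
    have a2 : x₂ ∈ convexHull ℝ ({x₀, x₁, x₂} : Set (EuclideanSpace ℝ (Fin n))) := s (by simp)
    have := hc.sum_mem (t := Finset.univ) (w := ![1 - q 0 - q 1, q 0, q 1]) (z := ![x₀, x₁, x₂])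
      (by intro i _; fin_cases i <;> simp <;> linarith) (by simp [Fin.sum_univ_three]; ring)
      (by intro i _; fin_cases i <;> simpa)
    convert this using 1
    simp [Fin.sum_univ_three, stPhi]
    module

theorem st_main {A : EuclideanSpace ℝ (Fin n) → EuclideanSpace ℝ (Fin n) →L[ℝ] M}
    {P : EuclideanSpace ℝ (Fin n) → EuclideanSpace ℝ (Fin n) → M}
    {U : Set (EuclideanSpace ℝ (Fin n))} (hU : IsOpen U) (hA : ContDiffOn ℝ (⊤ : ℕ∞) A U)
    (h : StPT A P U) (x₀ v w : EuclideanSpace ℝ (Fin n)) (hT : stT v w x₀ 1 ⊆ U) :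
    stH P v w x₀ 1 ≤ (1 / (2 * (Measure.hausdorffMeasure (2:ℝ) :
      Measure (EuclideanSpace ℝ (Fin 2))).real stO)) *
      ∫ y in stT v w x₀ 1, stCurv A y ∂(Measure.hausdorffMeasure (2:ℝ)) := by
  set c := (Measure.hausdorffMeasure (2:ℝ) : Measure (EuclideanSpace ℝ (Fin 2))).real stO with hc
  have hc0 : 0 < c := stO_pos
  have hdiff : ∀ z ∈ U, HasFDerivAt A (fderiv ℝ A z) z := fun z hz =>
    ((hA.contDiffAt (hU.mem_nhds hz)).differentiableAt (by simp)).hasFDerivAt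
  rcases st_gs v w with hdeg | ⟨e1, e2, α, β, γ, hα, hγ, h1, h2, h12, hv, hw⟩
  · have hF : ∀ z, ‖fderiv ℝ A z v w - fderiv ℝ A z w v + A z v * A z w - A z w * A z v‖ = 0 := by
      intro z
      rcases hdeg with rfl | ⟨c, rfl⟩
      · simp
      · simp
    have : stH P v w x₀ 1 ≤ 0 := by
      refine st_goursat v w x₀ (stH P v w) (fun a l _ hs => stH_sub h v w a l (hs.trans hT)) ?_
      intro z hz δ hδ
      obtain ⟨r, hr, H⟩ := stH_local h v w (hdiff z (hT hz)) δ hδ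
      refine ⟨r, hr, fun a l hl hlr hza hs => (H a l hl hlr hza (hs.trans hT)).trans ?_⟩
      rw [hF z]
      linarith
    refine this.trans ?_
    have := integral_nonneg (μ := (Measure.hausdorffMeasure (2:ℝ)).restrict (stT v w x₀ 1))
      (f := stCurv A) (fun y => st_curv_nonneg A y)
    positivity
  · set g := stCurv A with hg
    have g0 : ∀ x, 0 ≤ g x := st_curv_nonneg A
    have gc : ContinuousOn g U := st_curv_cont A hU hA
    have fin : ∀ a l, (Measure.hausdorffMeasure (2:ℝ)) (stT v w a l) < ⊤ := by
      intro a l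
      unfold stT
      rw [st_image_measure h1 h2 h12 hv hw]
      exact ENNReal.mul_lt_top ENNReal.ofReal_lt_top stTri_fin
    have hint : IntegrableOn g (stT v w x₀ 1) (Measure.hausdorffMeasure (2:ℝ)) := by
      have hK := stT_compact v w x₀ 1
      obtain ⟨B, hB⟩ := hK.exists_bound_of_continuousOn (gc.mono hT)
      exact IntegrableOn.of_bound (fin _ _)
        ((gc.mono hT).aestronglyMeasurable hK.measurableSet) B
        ((ae_restrict_iff' hK.measurableSet).2 (Filter.Eventually.of_forall hB))
    have hOT : ∀ a l, stOT v w a l ⊆ stT v w a l := fun a l => Set.image_mono stO_sub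
    have mOT : ∀ a l, l ≠ 0 → MeasurableSet (stOT v w a l) := fun a l hl =>
      ((stPhi_cont v w a l).measurableEmbedding
        (stPhi_inj h1 h2 h12 hv hw hα hγ a l hl)).measurableSet_image.2 stO_open.measurableSet
    have area : ∀ a l, (Measure.hausdorffMeasure (2:ℝ) :
        Measure (EuclideanSpace ℝ (Fin n))).real (stOT v w a l) = l^2 * |α * γ| * c := by
      intro a l
      rw [measureReal_def, stOT, st_image_measure h1 h2 h12 hv hw, ENNReal.toReal_mul,
        ENNReal.toReal_ofReal (by positivity), hc, measureReal_def]
    set K := |α * γ| with hK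
    have hK0 : 0 ≤ K := abs_nonneg _
    have hform : ∀ z, ‖fderiv ℝ A z v w - fderiv ℝ A z w v + A z v * A z w - A z w * A z v‖ ≤
        K * g z := by
      intro z
      have e : fderiv ℝ A z v w - fderiv ℝ A z w v + A z v * A z w - A z w * A z v =
          (α * γ) • (fderiv ℝ A z e1 e2 - fderiv ℝ A z e2 e1 + A z e1 * A z e2
            - A z e2 * A z e1) := by
        rw [hv, hw]
        simp only [map_smul, map_add, smul_apply, add_apply, smul_mul_assoc, mul_smul_comm,
          mul_add, add_mul]
        module
      rw [e, norm_smul, Real.norm_eq_abs]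
      exact mul_le_mul_of_nonneg_left (st_le_curv A z e1 e2 h1 h2) hK0
    have main : stH P v w x₀ 1 - 1 / (2 * c) *
        ∫ y in stOT v w x₀ 1, g y ∂(Measure.hausdorffMeasure (2:ℝ)) ≤ 0 := by
      refine st_goursat v w x₀ (fun a l => stH P v w a l - 1 / (2 * c) *
        ∫ y in stOT v w a l, g y ∂(Measure.hausdorffMeasure (2:ℝ))) ?_ ?_
      · intro a l hl hs
        have k1 := stH_sub h v w a l (hs.trans hT)
        have k2 := stOT_superadd h1 h2 h12 hv hw hα hγ a l hl g0 (hint.mono_set hs)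
        have k3 := mul_le_mul_of_nonneg_left k2 (by positivity : 0 ≤ 1 / (2 * c))
        simp only [mul_add] at k3
        simp only
        linarith
      · intro z hz δ hδ
        obtain ⟨r, hr, H⟩ := stH_local h v w (hdiff z (hT hz)) (δ/2) (by positivity)
        set η := δ / (K + 1) with hη
        have hη0 : 0 < η := by positivity
        have hηK : K * η ≤ δ := by
          rw [hη, mul_div_assoc', div_le_iff₀ (by positivity)]
          nlinarith
        obtain ⟨ρ, hρ, G⟩ := Metric.continuousWithinAt_iff.1 (gc z (hT hz)) η hη0
        set R := 2 * (‖v‖ + ‖w‖) with hR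
        have hR0 : 0 ≤ R := by positivity
        refine ⟨min r (ρ / (R + 1)), lt_min hr (by positivity), ?_⟩
        intro a l hl hlr hza hs
        have k1 := H a l hl (hlr.trans_le (min_le_left _ _)) hza (hs.trans hT)
        have hl2 : (R + 1) * |l| < ρ := by
          have := hlr.trans_le (min_le_right _ _)
          rwa [lt_div_iff₀ (by positivity), mul_comm] at this
        have low : ∀ y ∈ stOT v w a l, g z - η ≤ g y := by
          intro y hy
          have hyT := hOT a l hy
          have d : dist y z < ρ := by
            rw [dist_eq_norm]
            refine (stT_norm hyT hza).trans_lt (lt_of_le_of_lt ?_ hl2)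
            gcongr
            linarith
          have := G (hT (hs hyT)) d
          rw [Real.dist_eq, abs_lt] at this
          linarith
        have k2 := setIntegral_ge_of_const_le_real (mOT a l hl)
          (((measure_mono (hOT a l)).trans_lt (fin a l)).ne) low
          (hint.mono_set ((hOT a l).trans hs))
        rw [area] at k2
        have k3 := mul_le_mul_of_nonneg_left k2 (by positivity : 0 ≤ 1 / (2 * c))
        have e3 : 1 / (2 * c) * ((g z - η) * (l^2 * K * c)) = l^2 * (1/2 * (K * g z))
            - l^2 * (1/2 * (K * η)) := by
          field_simp
        have k4 := hform z
        have k5 : l^2 * (1/2 * (K * η)) ≤ l^2 * (1/2 * δ) := by gcongr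
        have k6 : l^2 * (1/2 * ‖fderiv ℝ A z v w - fderiv ℝ A z w v + A z v * A z w
          - A z w * A z v‖ + δ/2) ≤ l^2 * (1/2 * (K * g z) + δ/2) := by gcongr
        simp only
        rw [e3] at k3
        nlinarith
    have fin1 := setIntegral_mono_set hint (Filter.Eventually.of_forall g0)
      (hOT x₀ 1).eventuallyLE
    have fin2 := mul_le_mul_of_nonneg_left fin1 (by positivity : 0 ≤ 1 / (2 * c))
    linarith

end StokesFinal


/-- nonabelian Stokes estimate.  If P is the parallel transport
(holonomy) of the smooth connection A along segments, taking values in the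
unitary group, then the holonomy around a triangular loop differs from the
identity by at most a constant times the integral of |F(A)| over the solid
triangle with respect to 2-dimensional Hausdorff measure. -/
theorem nonabelian_stokes (N : ℕ) :
    ∃ C > 0, ∀ (n : ℕ)
      (A : EuclideanSpace ℝ (Fin n) → (EuclideanSpace ℝ (Fin n) →L[ℝ] MatN N))
      (U : Set (EuclideanSpace ℝ (Fin n))), IsOpen U → ContDiffOn ℝ (⊤ : ℕ∞) A U →
      ∀ (P : EuclideanSpace ℝ (Fin n) → EuclideanSpace ℝ (Fin n) → MatN N),
      -- P x x = 1_G
      (∀ x, P x x = 1) →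
      -- the defining ODE of parallel transport along segments inside U
      (∀ x y : EuclideanSpace ℝ (Fin n), segment ℝ x y ⊆ U →
        ∀ t ∈ Set.Icc (0:ℝ) 1,
          HasDerivAt (fun s : ℝ => P x (x + s • (y - x)))
            (P x (x + t • (y - x)) * A (x + t • (y - x)) (y - x)) t) →
      -- holonomies take values in the unitary group (in which G ⊆ U(N) sits)
      (∀ x y, P x y ∈ unitary (MatN N)) →
      ∀ x₀ x₁ x₂ : EuclideanSpace ℝ (Fin n),
        convexHull ℝ {x₀, x₁, x₂} ⊆ U →
        ‖P x₀ x₁ * P x₁ x₂ * P x₂ x₀ - 1‖ ≤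
          C * ∫ y in convexHull ℝ {x₀, x₁, x₂}, curvNorm n N A y
            ∂(MeasureTheory.Measure.hausdorffMeasure (2:ℝ)) := by
  refine ⟨1 / (2 * (Measure.hausdorffMeasure (2:ℝ) :
      Measure (EuclideanSpace ℝ (Fin 2))).real stO), by have := stO_pos; positivity, ?_⟩
  intro n A U hU hA P hP1 hP2 hP3 x₀ x₁ x₂ hT
  rw [st_hull] at hT ⊢
  have := st_main (M := MatN N) (P := P) hU hA ⟨hP1, hP2, hP3⟩ x₀ _ _ hT
  rw [stH, one_smul, one_smul, add_sub_cancel, add_sub_cancel] at this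
  rw [st_curv_eq]
  exact this
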